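/- arXiv:2405.03294 — 3 statements merged into one kernel-verified Lean document; each statement's English description precedes it below -/
import Mathlib

section
/- ∫₀^∞ sinh(x)/(x · cosh²(x)) dx = 4G/π, where G = Σ_{n=0}^∞ (-1)^n/(2n+1)² is the Catalan constant. -/
open Complex UpperHalfPlane in
lemma hasSum_csc (z : ℂ) (hz : 0 < z.im) :
    HasSum (fun n : ℤ => 1 / (z + n) ^ 2) (Real.pi ^ 2 / Complex.sin (Real.pi * z) ^ 2) := by
  have hs : Summable (fun n : ℤ => 1 / (z + n) ^ 2) := by
    have := EisensteinSeries.linear_right_summable z 1 (k := 2) (by norm_num)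
    refine this.congr fun n => ?_
    simp
    try norm_cast
  have h := iteratedDerivWithin_cot_pi_mul_eq_mul_tsum_div_pow (k := 1) le_rfl (z := z) hz
  have hsin : Complex.sin (Real.pi * z) ≠ 0 := by
    intro h0
    obtain ⟨k, hk⟩ := Complex.sin_eq_zero_iff.1 h0
    have hpi : (Real.pi : ℂ) ≠ 0 := by exact_mod_cast Real.pi_ne_zero
    have : z = (k : ℂ) := by
      apply mul_left_cancel₀ hpi; rw [hk]; ring
    rw [this] at hz
    simp at hz
  have hd : HasDerivAt (fun x : ℂ => (Real.pi : ℂ) * cot (Real.pi * x))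
      (-(Real.pi ^ 2 / Complex.sin (Real.pi * z) ^ 2)) z := by
    have hl : HasDerivAt (fun x : ℂ => (Real.pi : ℂ) * x) Real.pi z := by
      simpa using (hasDerivAt_id z).const_mul (Real.pi : ℂ)
    have := (((Complex.hasDerivAt_cos _).comp z hl).div
      ((Complex.hasDerivAt_sin _).comp z hl) hsin).const_mul (Real.pi : ℂ)
    have e : (fun x : ℂ => (Real.pi : ℂ) * cot (Real.pi * x)) = fun y => (Real.pi:ℂ) *
        ((Complex.cos ∘ fun x => (Real.pi:ℂ) * x) / Complex.sin ∘ fun x => (Real.pi:ℂ) * x) y := by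
      funext y; simp [Complex.cot]
    rw [e]
    refine this.congr_deriv ?_
    simp only [Function.comp]
    field_simp
    linear_combination (-1 : ℂ) * Complex.sin_sq_add_cos_sq (Real.pi * z)
  rw [iteratedDerivWithin_one,
    hd.hasDerivWithinAt.derivWithin (isOpen_upperHalfPlaneSet.uniqueDiffWithinAt hz)] at h
  simp at h
  have e := hs.hasSum
  have e2 : (Real.pi:ℂ) ^ 2 / Complex.sin (Real.pi * z) ^ 2 = ∑' n : ℤ, 1 / (z + n) ^ 2 := by
    simp [h]
  rw [e2]
  exact e

lemma sech_eq (x : ℝ) : Real.sinh x / Real.cosh x ^ 2 =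
    -(1/2) * (1 / Complex.sin (Real.pi * (1/4 + x / (2 * Real.pi) * Complex.I)) ^ 2).im := by
  have hpi : (Real.pi : ℂ) ≠ 0 := by exact_mod_cast Real.pi_ne_zero
  have h1 : Complex.sin (Real.pi * (1/4 + x / (2 * Real.pi) * Complex.I)) ^ 2
      = (1 + Real.sinh x * Complex.I) / 2 := by
    have hsq : ∀ w : ℂ, Complex.sin w ^ 2 = 1 / 2 - Complex.cos (2 * w) / 2 := by
      intro w
      rw [Complex.cos_two_mul, Complex.cos_sq']
      ring
    rw [hsq]
    have : 2 * ((Real.pi:ℂ) * (1/4 + x / (2 * Real.pi) * Complex.I)) =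
      Real.pi / 2 - (-(x * Complex.I)) := by field_simp; ring
    rw [this, Complex.cos_pi_div_two_sub, Complex.sin_neg, Complex.sin_mul_I]
    push_cast
    ring
  rw [h1]
  have h2 : (1 / ((1 + (Real.sinh x : ℂ) * Complex.I) / 2)).im = -2 * Real.sinh x / (Real.cosh x)^2 := by
    rw [Real.cosh_sq]
    rw [one_div_div]
    generalize Real.sinh x = s
    simp [Complex.div_im, Complex.normSq_apply]
    ring
  rw [h2]; ring

lemma im_term (c y : ℝ) (hc : c ≠ 0) : (1 / ((c : ℂ) + y * Complex.I) ^ 2).im =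
    - (2 * c * y) / (c ^ 2 + y ^ 2) ^ 2 := by
  have h0 : c ^ 2 + y ^ 2 ≠ 0 := by positivity
  simp [Complex.normSq_apply, pow_two]
  rw [pow_two, pow_two] at h0
  field_simp
  ring

lemma hasSum_pt (x : ℝ) (hx : 0 < x) :
    HasSum (fun n : ℤ => 4 * (2 * Real.pi * (n + 1/4)) / ((2 * Real.pi * ((n:ℝ) + 1/4)) ^ 2 + x ^ 2) ^ 2)
     (Real.sinh x / (x * Real.cosh x ^ 2)) := by
  have hp := Real.pi_pos
  have h := hasSum_csc (1/4 + x / (2 * Real.pi) * Complex.I) (by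
    have : ((1:ℂ)/4 + x / (2 * Real.pi) * Complex.I) = ((1/4 : ℝ) : ℂ) + ((x / (2 * Real.pi) : ℝ) : ℂ) * Complex.I := by push_cast; ring
    rw [this]
    simp only [Complex.add_im, Complex.ofReal_im, Complex.im_ofReal_mul, Complex.I_im]
    positivity)
  have h := (Complex.hasSum_im h).mul_left (-1 / (2 * Real.pi ^ 2) / x)
  refine Eq.mp (congrArg₂ (fun f a => HasSum (f : ℤ → ℝ) a) (funext fun n => ?_) ?_) h
  · symm
    have hn : (n : ℝ) + 1/4 ≠ 0 := by
      intro h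
      have h4 : (4 * (n:ℝ) + 1 : ℝ) = 0 := by linarith
      have h5 : (4 * n + 1 : ℤ) = 0 := by exact_mod_cast h4
      omega
    have e : (1/4 + x / (2 * Real.pi) * Complex.I + n : ℂ) = (((n:ℝ) + 1/4 : ℝ) : ℂ) + ((x / (2 * Real.pi) : ℝ) : ℂ) * Complex.I := by push_cast; ring
    rw [e, im_term _ _ hn]
    generalize (n:ℝ) + 1/4 = c at *
    have : (2 * Real.pi * c) ^ 2 + x ^ 2 ≠ 0 := by positivity
    have : c ^ 2 + (x / (2 * Real.pi)) ^ 2 = ((2 * Real.pi * c) ^ 2 + x ^ 2) / (4 * Real.pi ^ 2) := by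
      field_simp; ring
    rw [this]
    field_simp
    ring
  · symm
    have := sech_eq x
    rw [show Real.sinh x / (x * Real.cosh x ^ 2) = (Real.sinh x / Real.cosh x ^ 2) / x by
      field_simp, this]
    have e : ((Real.pi:ℂ) ^ 2 / Complex.sin (Real.pi * (1/4 + x / (2 * Real.pi) * Complex.I)) ^ 2) =
      ((Real.pi ^ 2 : ℝ) : ℂ) * (1 / Complex.sin (Real.pi * (1/4 + x / (2 * Real.pi) * Complex.I)) ^ 2) := by
      push_cast; ring
    rw [e, Complex.im_ofReal_mul]
    field_simp

lemma int_term (b : ℝ) (hb : 0 < b) :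
    MeasureTheory.IntegrableOn (fun x : ℝ => 1 / (b ^ 2 + x ^ 2) ^ 2) (Set.Ioi 0) ∧
    ∫ x in Set.Ioi (0:ℝ), 1 / (b ^ 2 + x ^ 2) ^ 2 = Real.pi / (4 * b ^ 3) := by
  set g : ℝ → ℝ := fun x => x / (2 * b ^ 2 * (b ^ 2 + x ^ 2)) + Real.arctan (x / b) / (2 * b ^ 3) with hg
  have hd : ∀ x ∈ Set.Ici (0:ℝ), HasDerivAt g (1 / (b ^ 2 + x ^ 2) ^ 2) x := by
    intro x _
    have h0 : b ^ 2 + x ^ 2 ≠ 0 := by positivity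
    have hden : HasDerivAt (fun x : ℝ => 2 * b ^ 2 * (b ^ 2 + x ^ 2)) (2 * b ^ 2 * (2 * x)) x := by
      simpa using (((hasDerivAt_id x).pow 2).const_add (b ^ 2)).const_mul (2 * b ^ 2)
    have h1 := (hasDerivAt_id x).div hden (by positivity)
    have h2 := (((hasDerivAt_id x).div_const b).arctan).div_const (2 * b ^ 3)
    refine (h1.add h2).congr_deriv ?_
    simp only [id]
    have : 1 + (x / b) ^ 2 = (b ^ 2 + x ^ 2) / b ^ 2 := by field_simp
    rw [this]
    field_simp
    ring
  have ht : Filter.Tendsto g Filter.atTop (nhds (0 + (Real.pi / 2) / (2 * b ^ 3))) := by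
    apply Filter.Tendsto.add
    · have h1 : Filter.Tendsto (fun x : ℝ => (1 / (2 * b ^ 2)) * x⁻¹) Filter.atTop (nhds 0) := by
        have := (tendsto_inv_atTop_zero (𝕜 := ℝ)).const_mul (1 / (2 * b ^ 2))
        rwa [mul_zero] at this
      refine squeeze_zero' ?_ ?_ h1
      · filter_upwards [Filter.eventually_gt_atTop 0] with x hx
        positivity
      · filter_upwards [Filter.eventually_gt_atTop 0] with x hx
        rw [← one_div, div_mul_div_comm, div_le_div_iff₀ (by positivity) (by positivity)]
        have : 0 < b ^ 4 := by positivity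
        nlinarith
    · apply Filter.Tendsto.div_const
      exact (Real.tendsto_arctan_atTop.mono_right nhdsWithin_le_nhds).comp
        (Filter.tendsto_id.atTop_div_const hb)
  have hpos : ∀ x ∈ Set.Ioi (0:ℝ), 0 ≤ 1 / (b ^ 2 + x ^ 2) ^ 2 := fun x _ => by positivity
  refine ⟨MeasureTheory.integrableOn_Ioi_deriv_of_nonneg' hd hpos ht, ?_⟩
  rw [MeasureTheory.integral_Ioi_of_hasDerivAt_of_nonneg' hd hpos ht]
  simp [hg]
  field_simp
  ring

lemma int_term' (b : ℝ) (hb : b ≠ 0) :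
    MeasureTheory.IntegrableOn (fun x : ℝ => 4 * b / (b ^ 2 + x ^ 2) ^ 2) (Set.Ioi 0) ∧
    ∫ x in Set.Ioi (0:ℝ), 4 * b / (b ^ 2 + x ^ 2) ^ 2 = Real.pi * b / |b| ^ 3 := by
  obtain ⟨h1, h2⟩ := int_term |b| (abs_pos.2 hb)
  simp only [sq_abs] at h1 h2
  constructor
  · refine MeasureTheory.IntegrableOn.congr_fun (h1.const_mul (4 * b)) (fun x _ => ?_) measurableSet_Ioi
    simp [div_eq_mul_inv]
  · simp_rw [div_eq_mul_one_div (4 * b)]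
    rw [MeasureTheory.integral_const_mul, h2]
    have := abs_pos.2 hb
    field_simp

lemma shift_ne (n : ℤ) : 2 * Real.pi * ((n:ℝ) + 1/4) ≠ 0 := by
  refine mul_ne_zero (by positivity) ?_
  intro h
  have h4 : (4 * (n:ℝ) + 1 : ℝ) = 0 := by linarith
  have h5 : (4 * n + 1 : ℤ) = 0 := by exact_mod_cast h4
  omega

lemma summable_shift : Summable (fun n : ℤ => Real.pi * |2 * Real.pi * ((n:ℝ) + 1/4)| /
    |2 * Real.pi * ((n:ℝ) + 1/4)| ^ 3) := by
  have h := (EisensteinSeries.linear_right_summable (1/4 : ℂ) 1 (k := 2) (by norm_num)).norm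
  refine (h.mul_left (1 / (4 * Real.pi))).congr fun n => ?_
  have hn := shift_ne n
  have e : (((1:ℤ) : ℂ) * (1/4) + n) = (((n:ℝ) + 1/4 : ℝ) : ℂ) := by push_cast; ring
  rw [e, norm_inv, norm_zpow, Complex.norm_real, Real.norm_eq_abs, abs_mul,
    abs_of_pos (by positivity : 0 < 2 * Real.pi)]
  have hp := Real.pi_pos
  have : 0 < |(n:ℝ) + 1/4| := abs_pos.2 (right_ne_zero_of_mul hn)
  norm_cast
  norm_cast at this
  field_simp
  norm_num

lemma hasSum_int : HasSum (fun n : ℤ => Real.pi * (2 * Real.pi * ((n:ℝ) + 1/4)) /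
    |2 * Real.pi * ((n:ℝ) + 1/4)| ^ 3)
    (∫ x in Set.Ioi (0 : ℝ), Real.sinh x / (x * Real.cosh x ^ 2)) := by
  have key := MeasureTheory.hasSum_integral_of_summable_integral_norm
    (μ := MeasureTheory.volume.restrict (Set.Ioi (0:ℝ)))
    (F := fun (n : ℤ) (x : ℝ) => 4 * (2 * Real.pi * ((n:ℝ) + 1/4)) /
      ((2 * Real.pi * ((n:ℝ) + 1/4)) ^ 2 + x ^ 2) ^ 2)
    (fun n => (int_term' _ (shift_ne n)).1) ?_
  · simp_rw [fun n : ℤ => (int_term' _ (shift_ne n)).2] at key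
    rwa [MeasureTheory.setIntegral_congr_fun measurableSet_Ioi
      (fun x hx => (hasSum_pt x hx).tsum_eq)] at key
  · refine summable_shift.congr fun n => ?_
    have h := (int_term' |2 * Real.pi * ((n:ℝ) + 1/4)| (abs_ne_zero.2 (shift_ne n))).2
    rw [abs_abs] at h
    rw [← h]
    congr 1
    ext x
    rw [Real.norm_eq_abs, abs_div, sq_abs, abs_mul (4:ℝ), abs_of_pos (by norm_num : (0:ℝ) < 4),
      abs_of_nonneg (by positivity : 0 ≤ ((2 * Real.pi * ((n:ℝ) + 1/4)) ^ 2 + x ^ 2) ^ 2)]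

/-- `∫₀^∞ sinh x / (x cosh² x) dx = 4G/π` where `G` is Catalan's constant. -/
theorem integral_sinh_div_cosh_sq :
    ∫ x in Set.Ioi (0 : ℝ), Real.sinh x / (x * Real.cosh x ^ 2) =
      4 * (∑' n : ℕ, (-1) ^ n / (2 * (n : ℝ) + 1) ^ 2) / Real.pi := by
  have H := hasSum_int
  have hp := Real.pi_pos
  set f : ℤ → ℝ := fun n : ℤ => Real.pi * (2 * Real.pi * ((n:ℝ) + 1/4)) /
    |2 * Real.pi * ((n:ℝ) + 1/4)| ^ 3 with hf
  have s1 : Summable (fun n : ℕ => f n) := H.summable.comp_injective Nat.cast_injective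
  have s2 : Summable (fun n : ℕ => f (-(n + 1))) :=
    H.summable.comp_injective (i := fun n : ℕ => (-((n:ℤ) + 1))) (by intro a b h; simpa using h)
  have hI := H.unique (s1.hasSum.of_nat_of_neg_add_one s2.hasSum)
  have hG : HasSum (fun n : ℕ => (-1 : ℝ) ^ n / (2 * (n : ℝ) + 1) ^ 2)
      (Real.pi / 4 * (∑' n : ℕ, f n) + Real.pi / 4 * (∑' n : ℕ, f (-(n + 1)))) := by
    apply HasSum.even_add_odd
    · refine Eq.mp (congrArg (fun g => HasSum (g : ℕ → ℝ) _) (funext fun n => ?_)) (s1.hasSum.mul_left (Real.pi / 4))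
      simp only [hf]
      push_cast
      rw [abs_of_pos (by positivity), pow_mul]
      norm_num
      field_simp
      ring
    · refine Eq.mp (congrArg (fun g => HasSum (g : ℕ → ℝ) _) (funext fun n => ?_)) (s2.hasSum.mul_left (Real.pi / 4))
      simp only [hf]
      push_cast
      rw [show 2 * Real.pi * (-((n:ℝ) + 1) + 1/4) = -(2 * Real.pi * ((n:ℝ) + 3/4)) by ring, abs_neg,
        abs_of_pos (by positivity), pow_succ (-1 : ℝ), pow_mul]
      norm_num
      field_simp
      ring
  rw [hG.tsum_eq, hI]
  field_simp
end

section
/- ∫₀^∞ sinh(u)/(u · cosh³(u)) du = 7ζ(3)/π², where ζ is the Riemann zeta function. -/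
open MeasureTheory Set Filter Topology

lemma coth_hasSum {y : ℝ} (hy : 0 < y) :
    HasSum (fun n : ℕ => 2 * y / (y ^ 2 + (((n : ℝ) + 1) * Real.pi) ^ 2))
      (Real.cosh y / Real.sinh y - 1 / y) := by
  have hpi : (Real.pi : ℂ) ≠ 0 := by exact_mod_cast Real.pi_ne_zero
  have hy0 : (y : ℂ) ≠ 0 := by exact_mod_cast hy.ne'
  have hs0 : (Real.sinh y : ℂ) ≠ 0 := by exact_mod_cast (Real.sinh_pos_iff.2 hy).ne'
  set x : ℂ := Complex.I * y / Real.pi with hx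
  have hxim : x.im = y / Real.pi := by
    rw [hx, Complex.div_ofReal_im]; simp
  have hxm : x ∈ Complex.integerComplement := by
    rintro ⟨m, hm⟩
    have := congrArg Complex.im hm
    rw [hxim] at this
    have hpos : 0 < y / Real.pi := by positivity
    rw [← this] at hpos
    simp at hpos
  have h1 := (summable_cotTerm hxm).hasSum
  have h2 : ∑' n : ℕ, cotTerm x n = Real.pi * Complex.cot (Real.pi * x) - 1 / x :=
    (cot_series_rep' hxm).symm
  rw [h2] at h1
  have h3 := h1.mul_left (Complex.I / Real.pi)
  rw [← Complex.hasSum_ofReal]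
  have hpx : (Real.pi : ℂ) * x = y * Complex.I := by rw [hx]; field_simp
  convert! h3 using 1
  · ext n
    rw [cotTerm_identity hxm]
    have hne : (y : ℂ) ^ 2 + (((n : ℂ) + 1) * Real.pi) ^ 2 ≠ 0 := by
      have : y ^ 2 + (((n : ℝ) + 1) * Real.pi) ^ 2 ≠ 0 := by positivity
      exact_mod_cast this
    have e : (x + (n + 1)) * (x - (n + 1)) =
        -((y : ℂ) ^ 2 + (((n : ℂ) + 1) * Real.pi) ^ 2) / Real.pi ^ 2 := by
      rw [hx]; field_simp; ring_nf; simp only [Complex.I_sq]; ring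
    rw [e, hx]
    push_cast
    field_simp
    ring_nf; simp only [Complex.I_sq]; ring
  · rw [hpx, Complex.cot, Complex.cos_mul_I, Complex.sin_mul_I, hx]
    push_cast at hs0 ⊢
    field_simp
    try ring_nf
    try simp only [Complex.I_sq]
    try ring

lemma tanh_hasSum {u : ℝ} (hu : 0 < u) :
    HasSum (fun k : ℕ => 2 / (u ^ 2 + ((2 * (k : ℝ) + 1) * (Real.pi / 2)) ^ 2))
      (Real.tanh u / u) := by
  have h1 := (coth_hasSum (y := 2 * u) (by positivity)).mul_left 2
  have h2 := coth_hasSum hu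
  set f : ℕ → ℝ := fun n => 2 * (2 * (2 * u) / ((2 * u) ^ 2 + (((n : ℝ) + 1) * Real.pi) ^ 2))
  have hodd : ∀ k : ℕ, f (2 * k + 1) = 2 * u / (u ^ 2 + (((k : ℝ) + 1) * Real.pi) ^ 2) := by
    intro k
    simp only [f]
    push_cast
    have : u ^ 2 + (((k : ℝ) + 1) * Real.pi) ^ 2 ≠ 0 := by positivity
    have : (2 * u) ^ 2 + (((2 * k + 1 : ℝ) + 1) * Real.pi) ^ 2 ≠ 0 := by positivity
    field_simp
    ring
  have h2' : HasSum (fun k => f (2 * k + 1)) (Real.cosh u / Real.sinh u - 1 / u) := by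
    simpa only [hodd] using h2
  have hev : Summable (fun k => f (2 * k)) :=
    h1.summable.comp_injective (i := fun k : ℕ => 2 * k) (fun a b h => by simpa using h)
  have h3 := hev.hasSum
  have h4 := (h3.even_add_odd h2').unique h1
  have hsinh : Real.sinh u ≠ 0 := (Real.sinh_pos_iff.2 hu).ne'
  have hcosh : Real.cosh u ≠ 0 := (Real.cosh_pos u).ne'
  have h5 : ∑' k, f (2 * k) = Real.tanh u := by
    rw [eq_sub_of_add_eq h4, Real.tanh_eq_sinh_div_cosh, Real.cosh_two_mul, Real.sinh_two_mul]
    field_simp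
    ring
  rw [h5] at h3
  have h6 := h3.div_const u
  convert! h6 using 2 with k
  simp only [f]
  push_cast
  have : u ^ 2 + ((2 * (k : ℝ) + 1) * (Real.pi / 2)) ^ 2 ≠ 0 := by positivity
  have : (2 * u) ^ 2 + ((2 * (k : ℝ) + 1) * Real.pi) ^ 2 ≠ 0 := by positivity
  field_simp

lemma lint_of_deriv {g g' : ℝ → ℝ} {l : ℝ} (hd : ∀ x ∈ Ici (0:ℝ), HasDerivAt g (g' x) x)
    (hp : ∀ x ∈ Ioi (0:ℝ), 0 ≤ g' x) (hl : Tendsto g atTop (𝓝 l)) :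
    ∫⁻ x in Ioi (0:ℝ), ENNReal.ofReal (g' x) = ENNReal.ofReal (l - g 0) := by
  rw [← integral_Ioi_of_hasDerivAt_of_nonneg' hd hp hl, ofReal_integral_eq_lintegral_ofReal]
  · exact integrableOn_Ioi_deriv_of_nonneg' hd hp hl
  · exact (ae_restrict_iff' measurableSet_Ioi).2 (ae_of_all _ hp)

lemma lint_exp {c : ℝ} (hc : 0 < c) :
    ∫⁻ x in Ioi (0:ℝ), ENNReal.ofReal (Real.exp (-(c * x))) = ENNReal.ofReal (1 / c) := by
  have hl : Tendsto (fun x => -(Real.exp (-(c * x)) / c)) atTop (𝓝 0) := by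
    have : Tendsto (fun x => Real.exp (-(c * x))) atTop (𝓝 0) :=
      Real.tendsto_exp_neg_atTop_nhds_zero.comp (tendsto_id.const_mul_atTop hc)
    simpa using (this.div_const c).neg
  rw [lint_of_deriv (g := fun x => -(Real.exp (-(c * x)) / c)) _ (fun x _ => (Real.exp_pos _).le) hl]
  · simp
  · intro x _
    have := (((((hasDerivAt_id' x).const_mul c).neg).exp).div_const c).neg
    convert! this using 1
    simp
    field_simp

lemma lint_mul_exp {c : ℝ} (hc : 0 < c) :
    ∫⁻ x in Ioi (0:ℝ), ENNReal.ofReal (x * Real.exp (-(c * x))) = ENNReal.ofReal (1 / c ^ 2) := by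
  have hl : Tendsto (fun x => -((c * x + 1) * Real.exp (-(c * x)) / c ^ 2)) atTop (𝓝 0) := by
    have h1 : Tendsto (fun x => Real.exp (-(c * x))) atTop (𝓝 0) :=
      Real.tendsto_exp_neg_atTop_nhds_zero.comp (tendsto_id.const_mul_atTop hc)
    have h2 : Tendsto (fun x => (c * x) ^ 1 * Real.exp (-(c * x))) atTop (𝓝 0) :=
      (Real.tendsto_pow_mul_exp_neg_atTop_nhds_zero 1).comp (tendsto_id.const_mul_atTop hc)
    have h3 := ((h2.add h1).div_const (c ^ 2)).neg
    simp only [add_zero, zero_div, neg_zero] at h3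
    refine h3.congr fun x => ?_
    ring
  rw [lint_of_deriv (g := fun x => -((c * x + 1) * Real.exp (-(c * x)) / c ^ 2)) _
    (fun x hx => mul_nonneg (le_of_lt hx) (Real.exp_pos _).le) hl]
  · simp
  · intro x _
    have h0 := ((hasDerivAt_id' x).const_mul c)
    have := (((h0.add_const 1).mul (h0.neg.exp)).div_const (c ^ 2)).neg
    convert! this using 1
    simp
    field_simp
    ring

lemma lint_rat {a b : ℝ} (ha : 0 < a) (hb : 0 < b) :
    ∫⁻ x in Ioi (0:ℝ), ENNReal.ofReal (1 / ((x ^ 2 + a ^ 2) * (x ^ 2 + b ^ 2))) =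
      ENNReal.ofReal (Real.pi / (2 * a * b * (a + b))) := by
  have hat : ∀ c : ℝ, 0 < c → Tendsto (fun x => Real.arctan (x / c)) atTop (𝓝 (Real.pi / 2)) := by
    intro c hc
    exact (Real.tendsto_arctan_atTop.mono_right nhdsWithin_le_nhds).comp
      (tendsto_id.atTop_div_const hc)
  have had : ∀ c x : ℝ, 0 < c → HasDerivAt (fun x => Real.arctan (x / c)) (c / (x ^ 2 + c ^ 2)) x := by
    intro c x hc
    have := ((hasDerivAt_id' x).div_const c).arctan
    convert! this using 1
    have : x ^ 2 + c ^ 2 ≠ 0 := by positivity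
    simp
    field_simp
    ring
  by_cases hab : a = b
  · subst hab
    have hr : Tendsto (fun x : ℝ => x / (x ^ 2 + a ^ 2)) atTop (𝓝 0) := by
      refine squeeze_zero' (g := fun x : ℝ => x⁻¹) ?_ ?_ tendsto_inv_atTop_zero
      · filter_upwards [eventually_gt_atTop 0] with x hx
        positivity
      · filter_upwards [eventually_gt_atTop 0] with x hx
        rw [div_le_iff₀ (by positivity)]
        field_simp
        nlinarith [sq_nonneg a]
    have hl := (hr.div_const (2 * a ^ 2)).add ((hat a ha).div_const (2 * a ^ 3))
    rw [lint_of_deriv _ (fun x _ => by positivity) hl]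
    · congr 1
      simp
      field_simp
      ring
    · intro x _
      have hne : x ^ 2 + a ^ 2 ≠ 0 := by positivity
      have := (((hasDerivAt_id' x).div (((hasDerivAt_id' x).pow 2).add_const (a ^ 2)) hne).div_const
        (2 * a ^ 2)).add ((had a x ha).div_const (2 * a ^ 3))
      convert! this using 1
      simp
      field_simp
      ring
  · have hd : b ^ 2 - a ^ 2 ≠ 0 := by
      intro h
      apply hab
      nlinarith
    have hd' : b - a ≠ 0 := fun h => hab (by linarith)
    have hl := (((hat a ha).div_const a).sub ((hat b hb).div_const b)).div_const (b ^ 2 - a ^ 2)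
    rw [lint_of_deriv _ (fun x _ => by positivity) hl]
    · congr 1
      simp
      have : b ^ 2 - a ^ 2 = (b - a) * (b + a) := by ring
      rw [this]
      field_simp
      ring
    · intro x _
      have hne : x ^ 2 + a ^ 2 ≠ 0 := by positivity
      have hne : x ^ 2 + b ^ 2 ≠ 0 := by positivity
      have := (((had a x ha).div_const a).sub ((had b x hb).div_const b)).div_const (b ^ 2 - a ^ 2)
      convert! this using 1
      field_simp
      ring

/-- The self-inverse function `-log tanh (t/2)`. -/
noncomputable def phi (t : ℝ) : ℝ := Real.log (1 + Real.exp (-t)) - Real.log (1 - Real.exp (-t))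

lemma exp_neg_lt {t : ℝ} (ht : 0 < t) : Real.exp (-t) < 1 := by
  rw [Real.exp_lt_one_iff]; linarith

lemma phi_hasSum {t : ℝ} (ht : 0 < t) :
    HasSum (fun k : ℕ => 2 / (2 * (k : ℝ) + 1) * Real.exp (-((2 * k + 1) * t))) (phi t) := by
  have h := Real.hasSum_log_sub_log_of_abs_lt_one (x := Real.exp (-t))
    (by rw [abs_of_pos (Real.exp_pos _)]; exact exp_neg_lt ht)
  unfold phi
  convert! h using 1
  ext k
  rw [← Real.exp_nat_mul]
  push_cast
  have : -((2 * (k : ℝ) + 1) * t) = (2 * k + 1) * -t := by ring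
  rw [this]
  ring

lemma phi_pos {t : ℝ} (ht : 0 < t) : 0 < phi t := by
  have h1 := exp_neg_lt ht
  have h2 := Real.exp_pos (-t)
  have := Real.log_lt_log (x := 1 - Real.exp (-t)) (y := 1 + Real.exp (-t)) (by linarith) (by linarith)
  unfold phi
  linarith

lemma lt_phi_iff {t y : ℝ} (ht : 0 < t) :
    y < phi t ↔ Real.exp y * Real.exp t < 1 + Real.exp y + Real.exp t := by
  have h1 := exp_neg_lt ht
  have h2 := Real.exp_pos (-t)
  have h3 := Real.exp_pos t
  unfold phi
  rw [← Real.log_div (by linarith) (by linarith), Real.lt_log_iff_exp_lt (by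
    apply div_pos <;> linarith), lt_div_iff₀ (by linarith)]
  have h4 : Real.exp (-t) * Real.exp t = 1 := by rw [← Real.exp_add]; simp
  rw [← mul_lt_mul_iff_left₀ h3]
  have e1 : Real.exp y * (1 - Real.exp (-t)) * Real.exp t = Real.exp y * Real.exp t - Real.exp y := by
    linear_combination (-Real.exp y) * h4
  have e2 : (1 + Real.exp (-t)) * Real.exp t = Real.exp t + 1 := by
    linear_combination h4
  rw [e1, e2]
  constructor <;> intro h <;> linarith

lemma ofReal_phi {t : ℝ} (ht : 0 < t) : ENNReal.ofReal (phi t) =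
    ∑' k : ℕ, ENNReal.ofReal (2 / (2 * (k : ℝ) + 1) * Real.exp (-((2 * k + 1) * t))) := by
  rw [← (phi_hasSum ht).tsum_eq, ENNReal.ofReal_tsum_of_nonneg (fun k => by positivity)
    (phi_hasSum ht).summable]

/-- The symmetric region. -/
def R : Set (ℝ × ℝ) := {p | Real.exp p.1 * Real.exp p.2 < 1 + Real.exp p.1 + Real.exp p.2}

lemma R_meas : MeasurableSet R := by
  apply measurableSet_lt <;> fun_prop

lemma lint_two_mul {c : ℝ} (hc : 0 ≤ c) :
    ∫⁻ y in Ioo (0:ℝ) c, ENNReal.ofReal (2 * y) = ENNReal.ofReal (c ^ 2) := by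
  rw [← ofReal_integral_eq_lintegral_ofReal]
  · rw [← integral_Ioc_eq_integral_Ioo, ← intervalIntegral.integral_of_le hc]
    rw [intervalIntegral.integral_const_mul, integral_id]
    congr 1
    ring
  · exact (Continuous.integrableOn_Icc (by fun_prop)).mono_set Ioo_subset_Icc_self
  · refine (ae_restrict_iff' measurableSet_Ioo).2 (ae_of_all _ fun x hx => ?_)
    have := hx.1
    change (0:ℝ) ≤ 2 * x
    linarith

lemma phi_swap : ∫⁻ t in Ioi (0:ℝ), ENNReal.ofReal (phi t ^ 2) =
    ∫⁻ t in Ioi (0:ℝ), ENNReal.ofReal (2 * t) * ENNReal.ofReal (phi t) := by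
  have e1 : ∀ t ∈ Ioi (0:ℝ), ENNReal.ofReal (phi t ^ 2) =
      ∫⁻ y in Ioi (0:ℝ), R.indicator (fun p => ENNReal.ofReal (2 * p.2)) (t, y) := by
    intro t ht
    rw [← lint_two_mul (phi_pos ht).le, ← lintegral_indicator measurableSet_Ioo,
      ← lintegral_indicator measurableSet_Ioi]
    congr 1
    ext y
    have := lt_phi_iff (y := y) ht
    simp only [indicator, mem_Ioo, mem_Ioi, R, mem_ofPred_eq]
    simp only [this]
    have : Real.exp y * Real.exp t < 1 + Real.exp y + Real.exp t ↔
      Real.exp t * Real.exp y < 1 + Real.exp t + Real.exp y := by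
      constructor <;> intro h <;> linarith
    by_cases h1 : 0 < y <;>
      by_cases h2 : Real.exp t * Real.exp y < 1 + Real.exp t + Real.exp y <;> simp [this, h1, h2]
  have e2 : ∀ y ∈ Ioi (0:ℝ), ENNReal.ofReal (2 * y) * ENNReal.ofReal (phi y) =
      ∫⁻ t in Ioi (0:ℝ), R.indicator (fun p => ENNReal.ofReal (2 * p.2)) (t, y) := by
    intro y hy
    have : ENNReal.ofReal (phi y) = volume (Ioo 0 (phi y)) := by simp
    rw [this, ← setLIntegral_const, ← lintegral_indicator measurableSet_Ioo,
      ← lintegral_indicator measurableSet_Ioi]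
    congr 1
    ext t
    have := lt_phi_iff (y := t) hy
    simp only [indicator, mem_Ioo, mem_Ioi, R, mem_ofPred_eq]
    by_cases h1 : 0 < t <;>
      by_cases h2 : Real.exp t * Real.exp y < 1 + Real.exp t + Real.exp y <;> simp [this, h1, h2]
  rw [setLIntegral_congr_fun measurableSet_Ioi e1, setLIntegral_congr_fun measurableSet_Ioi e2]
  apply lintegral_lintegral_swap
  apply Measurable.aemeasurable
  exact Measurable.indicator (by fun_prop) R_meas

lemma double_sum : ∑' j : ℕ, ∑' k : ℕ, ENNReal.ofReal
      (4 / ((2 * (j : ℝ) + 1) * (2 * k + 1) * ((2 * j + 1) + (2 * k + 1)))) =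
    ∑' k : ℕ, ENNReal.ofReal (4 / (2 * (k : ℝ) + 1) ^ 3) := by
  have h := phi_swap
  have e1 : ∀ t ∈ Ioi (0:ℝ), ENNReal.ofReal (phi t ^ 2) = ∑' j : ℕ, ∑' k : ℕ,
      ENNReal.ofReal (4 / ((2 * (j : ℝ) + 1) * (2 * k + 1))) *
        ENNReal.ofReal (Real.exp (-(((2 * j + 1) + (2 * k + 1)) * t))) := by
    intro t ht
    rw [pow_two, ENNReal.ofReal_mul (phi_pos ht).le, ofReal_phi ht, ← ENNReal.tsum_mul_right]
    congr 1; ext j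
    rw [← ENNReal.tsum_mul_left]
    congr 1; ext k
    rw [← ENNReal.ofReal_mul (by positivity), ← ENNReal.ofReal_mul (by positivity)]
    congr 1
    have e : -(((2 * (j : ℝ) + 1) + (2 * k + 1)) * t) = -((2 * j + 1) * t) + -((2 * k + 1) * t) := by ring
    rw [e, Real.exp_add]
    field_simp
    ring
  have e2 : ∀ t ∈ Ioi (0:ℝ), ENNReal.ofReal (2 * t) * ENNReal.ofReal (phi t) = ∑' k : ℕ,
      ENNReal.ofReal (4 / (2 * (k : ℝ) + 1)) * ENNReal.ofReal (t * Real.exp (-((2 * k + 1) * t))) := by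
    intro t ht
    have ht' : 0 < t := ht
    rw [ofReal_phi ht, ← ENNReal.tsum_mul_left]
    congr 1; ext k
    rw [← ENNReal.ofReal_mul (by positivity), ← ENNReal.ofReal_mul (by positivity)]
    congr 1
    ring
  rw [setLIntegral_congr_fun measurableSet_Ioi e1, setLIntegral_congr_fun measurableSet_Ioi e2,
    lintegral_tsum (fun j => by fun_prop), lintegral_tsum (fun j => by fun_prop)] at h
  convert! h using 1
  · congr 1; ext j
    rw [lintegral_tsum (fun j => by fun_prop)]
    congr 1; ext k
    rw [lintegral_const_mul _ (by fun_prop), lint_exp (by positivity),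
      ← ENNReal.ofReal_mul (by positivity)]
    congr 1
    field_simp
  · congr 1; ext k
    rw [lintegral_const_mul _ (by fun_prop), lint_mul_exp (by positivity),
      ← ENNReal.ofReal_mul (by positivity)]
    congr 1
    field_simp

lemma odd_sum : HasSum (fun k : ℕ => 4 / (2 * (k : ℝ) + 1) ^ 3)
    (7 / 2 * (∑' m : ℕ, (1 : ℝ) / ((m : ℝ) + 1) ^ 3)) := by
  have hs : Summable (fun m : ℕ => (1 : ℝ) / ((m : ℝ) + 1) ^ 3) := by
    have := (summable_nat_add_iff 1).2 (Real.summable_one_div_nat_pow.2 (by norm_num : 1 < 3))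
    simpa using this
  set f : ℕ → ℝ := fun m => (1 : ℝ) / ((m : ℝ) + 1) ^ 3
  have hev : Summable (fun k => f (2 * k)) :=
    hs.comp_injective (i := fun k : ℕ => 2 * k) (fun a b h => by simpa using h)
  have ho : HasSum (fun k => f (2 * k + 1)) ((∑' m, f m) / 8) := by
    convert! hs.hasSum.div_const 8 using 1
    ext k
    simp only [f]
    push_cast
    field_simp
    ring
  have h4 := (hev.hasSum.even_add_odd ho).unique hs.hasSum
  have h5 := hev.hasSum.mul_left 4
  convert! h5 using 1
  · ext k
    simp only [f]
    push_cast
    ring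
  · linarith

lemma lint_tanh : ∫⁻ u in Ioi (0:ℝ), ENNReal.ofReal ((Real.tanh u / u) ^ 2) =
    ENNReal.ofReal (14 * (∑' m : ℕ, (1 : ℝ) / ((m : ℝ) + 1) ^ 3) / Real.pi ^ 2) := by
  have e1 : ∀ u ∈ Ioi (0:ℝ), ENNReal.ofReal ((Real.tanh u / u) ^ 2) = ∑' j : ℕ, ∑' k : ℕ,
      4 * ENNReal.ofReal (1 / ((u ^ 2 + ((2 * (j : ℝ) + 1) * (Real.pi / 2)) ^ 2) *
        (u ^ 2 + ((2 * (k : ℝ) + 1) * (Real.pi / 2)) ^ 2))) := by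
    intro u hu
    have hs := tanh_hasSum hu
    have h0 : 0 ≤ Real.tanh u / u := hs.nonneg (fun k => by positivity)
    rw [pow_two, ENNReal.ofReal_mul h0, ← hs.tsum_eq,
      ENNReal.ofReal_tsum_of_nonneg (fun k => by positivity) hs.summable, ← ENNReal.tsum_mul_right]
    congr 1; ext j
    rw [← ENNReal.tsum_mul_left]
    congr 1; ext k
    have : (4 : ENNReal) = ENNReal.ofReal 4 := by simp
    rw [this, ← ENNReal.ofReal_mul (by positivity), ← ENNReal.ofReal_mul (by positivity)]
    congr 1
    field_simp
    ring
  rw [setLIntegral_congr_fun measurableSet_Ioi e1, lintegral_tsum (fun j => by fun_prop)]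
  have e2 : ∀ j : ℕ, ∫⁻ u in Ioi (0:ℝ), ∑' k : ℕ,
      4 * ENNReal.ofReal (1 / ((u ^ 2 + ((2 * (j : ℝ) + 1) * (Real.pi / 2)) ^ 2) *
        (u ^ 2 + ((2 * (k : ℝ) + 1) * (Real.pi / 2)) ^ 2))) = ∑' k : ℕ,
      ENNReal.ofReal (4 / Real.pi ^ 2) * ENNReal.ofReal
      (4 / ((2 * (j : ℝ) + 1) * (2 * k + 1) * ((2 * j + 1) + (2 * k + 1)))) := by
    intro j
    rw [lintegral_tsum (fun j => by fun_prop)]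
    congr 1; ext k
    rw [lintegral_const_mul _ (by fun_prop), lint_rat (by positivity) (by positivity)]
    have : (4 : ENNReal) = ENNReal.ofReal 4 := by simp
    rw [this, ← ENNReal.ofReal_mul (by positivity), ← ENNReal.ofReal_mul (by positivity)]
    congr 1
    field_simp
    ring
  simp_rw [e2, ENNReal.tsum_mul_left]
  rw [double_sum, ← ENNReal.ofReal_tsum_of_nonneg (fun k => by positivity) odd_sum.summable,
    odd_sum.tsum_eq, ← ENNReal.ofReal_mul (by positivity)]
  congr 1
  ring

lemma hasDerivAt_tanh' (x : ℝ) : HasDerivAt Real.tanh (1 / Real.cosh x ^ 2) x := by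
  have h := (Real.hasDerivAt_sinh x).div (Real.hasDerivAt_cosh x) (Real.cosh_pos x).ne'
  have e : Real.tanh = Real.sinh / Real.cosh := by
    ext y; simp [Real.tanh_eq_sinh_div_cosh]
  rw [e]
  convert! h using 1
  congr 1
  nlinarith [Real.cosh_sq x]

lemma tanh_tendsto : Tendsto Real.tanh atTop (𝓝 1) := by
  have h1 : Tendsto (fun x => Real.exp (-(2 * x))) atTop (𝓝 0) :=
      Real.tendsto_exp_neg_atTop_nhds_zero.comp (tendsto_id.const_mul_atTop (by norm_num : (0:ℝ) < 2))
  have h2 := ((h1.const_sub 1).div (h1.const_add 1) (by norm_num))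
  norm_num at h2
  refine h2.congr fun x => ?_
  have e : Real.exp (-(2 * x)) = Real.exp (-x) * Real.exp (-x) := by
    rw [← Real.exp_add]; ring_nf
  have e3 : Real.exp x * Real.exp (-x) = 1 := by rw [← Real.exp_add]; simp
  have p1 := Real.exp_pos x
  have p2 := Real.exp_pos (-x)
  simp only [Pi.div_apply]
  rw [Real.tanh_eq_sinh_div_cosh, Real.sinh_eq, Real.cosh_eq, e]
  rw [div_eq_div_iff (by positivity) (by positivity)]
  linear_combination (-Real.exp (-x)) * e3

lemma tanh_le_self {u : ℝ} (hu : 0 < u) : Real.tanh u ≤ u := by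
  have hd : ∀ x : ℝ, HasDerivAt (fun x => x - Real.tanh x) (1 - 1 / Real.cosh x ^ 2) x :=
    fun x => (hasDerivAt_id' x).sub (hasDerivAt_tanh' x)
  have hm : Monotone (fun x => x - Real.tanh x) := by
    apply monotone_of_deriv_nonneg (fun x => (hd x).differentiableAt)
    intro x
    rw [(hd x).deriv, sub_nonneg, div_le_one (by have := Real.cosh_pos x; positivity)]
    nlinarith [Real.one_le_cosh x]
  have := hm hu.le
  simp at this
  exact this

lemma tanh_nonneg' {u : ℝ} (hu : 0 < u) : 0 ≤ Real.tanh u := by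
  rw [Real.tanh_eq_sinh_div_cosh]
  exact div_nonneg (Real.sinh_pos_iff.2 hu).le (Real.cosh_pos u).le

/-- `∫₀^∞ sinh u / (u cosh³ u) du = 7ζ(3)/π²`. -/
theorem integral_sinh_div_cosh_cube :
    ∫ u in Set.Ioi (0 : ℝ), Real.sinh u / (u * Real.cosh u ^ 3) =
      7 * (∑' m : ℕ, (1 : ℝ) / ((m : ℝ) + 1) ^ 3) / Real.pi ^ 2 := by
  set Z := ∑' m : ℕ, (1 : ℝ) / ((m : ℝ) + 1) ^ 3 with hZ
  have hZ0 : 0 ≤ Z := tsum_nonneg fun m => by positivity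
  have ctanh : Continuous Real.tanh :=
    continuous_iff_continuousAt.2 fun x => (hasDerivAt_tanh' x).continuousAt
  have mtanh : Measurable Real.tanh := ctanh.measurable
  have hnn : 0 ≤ᵐ[volume.restrict (Ioi (0:ℝ))] fun u => (Real.tanh u / u) ^ 2 :=
    ae_of_all _ fun u => sq_nonneg _
  have hint : IntegrableOn (fun u => (Real.tanh u / u) ^ 2) (Ioi 0) := by
    refine ⟨(by fun_prop : Measurable fun u => (Real.tanh u / u) ^ 2).aestronglyMeasurable, ?_⟩
    rw [hasFiniteIntegral_iff_ofReal hnn, lint_tanh]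
    exact ENNReal.ofReal_lt_top
  have hval : ∫ u in Ioi (0:ℝ), (Real.tanh u / u) ^ 2 = 14 * Z / Real.pi ^ 2 := by
    rw [integral_eq_lintegral_of_nonneg_ae hnn hint.1, lint_tanh, ENNReal.toReal_ofReal]
    positivity
  have hsech : IntegrableOn (fun u => 1 / Real.cosh u ^ 2) (Ioi 0) :=
    integrableOn_Ioi_deriv_of_nonneg' (fun x _ => hasDerivAt_tanh' x)
      (fun x _ => by positivity) tanh_tendsto
  have hI : IntegrableOn (fun u => Real.sinh u / (u * Real.cosh u ^ 3)) (Ioi 0) := by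
    refine Integrable.mono' hsech (by
      have : Measurable fun u => Real.sinh u / (u * Real.cosh u ^ 3) := by fun_prop
      exact this.aestronglyMeasurable) ?_
    refine (ae_restrict_iff' measurableSet_Ioi).2 (ae_of_all _ fun u (hu : 0 < u) => ?_)
    have hc := Real.cosh_pos u
    have h1 := tanh_le_self hu
    have h2 := tanh_nonneg' hu
    have e : Real.sinh u / (u * Real.cosh u ^ 3) = Real.tanh u / u * (1 / Real.cosh u ^ 2) := by
      rw [Real.tanh_eq_sinh_div_cosh]; field_simp
    rw [e, Real.norm_of_nonneg (by positivity)]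
    exact mul_le_of_le_one_left (by positivity) ((div_le_one hu).2 h1)
  have hv : ∀ x ∈ Ioi (0:ℝ), HasDerivAt (fun u => Real.tanh u ^ 2 / 2)
      (Real.sinh x / Real.cosh x ^ 3) x := by
    intro x _
    have hc := Real.cosh_pos x
    convert! ((hasDerivAt_tanh' x).pow 2).div_const 2 using 1
    rw [Real.tanh_eq_sinh_div_cosh]
    norm_num
    field_simp
  have hu : ∀ x ∈ Ioi (0:ℝ), HasDerivAt (fun u : ℝ => u⁻¹) (-(x ^ 2)⁻¹) x := by
    intro x hx
    exact hasDerivAt_inv (ne_of_gt hx)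
  have ea : ((fun u : ℝ => u⁻¹) * fun x => Real.sinh x / Real.cosh x ^ 3) =
      fun u => Real.sinh u / (u * Real.cosh u ^ 3) := by
    ext u
    simp only [Pi.mul_apply, div_eq_mul_inv, mul_inv]
    ring
  have eb : ((fun x : ℝ => -(x ^ 2)⁻¹) * fun u => Real.tanh u ^ 2 / 2) =
      fun u => (-1 / 2) * (Real.tanh u / u) ^ 2 := by
    ext u
    simp only [Pi.mul_apply, div_eq_mul_inv, mul_pow, inv_pow]
    ring
  have key := integral_Ioi_mul_deriv_eq_deriv_mul (a := 0) (a' := (0:ℝ)) (b' := (0:ℝ)) hu hv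
    (by rw [ea]; exact hI) (by rw [eb]; exact hint.const_mul _) ?_ ?_
  · have ea' : ∀ u : ℝ, u⁻¹ * (Real.sinh u / Real.cosh u ^ 3) = Real.sinh u / (u * Real.cosh u ^ 3) :=
      fun u => congrFun ea u
    have eb' : ∀ u : ℝ, -(u ^ 2)⁻¹ * (Real.tanh u ^ 2 / 2) = (-1 / 2) * (Real.tanh u / u) ^ 2 :=
      fun u => congrFun eb u
    simp only [ea', eb'] at key
    rw [key, integral_const_mul, hval]
    ring
  · have hid : Tendsto (fun u : ℝ => u / 2) (𝓝[>] 0) (𝓝 0) := by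
      have : Tendsto (fun u : ℝ => u / 2) (𝓝 0) (𝓝 (0 / 2)) :=
        (continuous_id.div_const 2).tendsto 0
      rw [zero_div] at this
      exact this.mono_left nhdsWithin_le_nhds
    refine squeeze_zero' ?_ ?_ hid
    · filter_upwards [self_mem_nhdsWithin] with u (hu : 0 < u)
      simp only [Pi.mul_apply]
      positivity
    · filter_upwards [self_mem_nhdsWithin] with u (hu : 0 < u)
      have h1 := tanh_le_self hu
      have h2 := tanh_nonneg' hu
      simp only [Pi.mul_apply]
      rw [inv_mul_le_iff₀ hu]
      nlinarith
  · have := tendsto_inv_atTop_zero.mul ((tanh_tendsto.pow 2).div_const 2)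
    rw [zero_mul] at this
    exact this
end

section
/- ζ(3) + 2 Σ_{k=1}^∞ 1/(k³(e^{2πk} − 1)) = 7π³/180, where ζ is the Riemann zeta function. -/
open Real in
lemma aux_cot (k : ℕ) : HasSum (fun n : ℕ => (1:ℝ) / (((k:ℝ)+1)^2 + ((n:ℝ)+1)^2))
    ((π * (1 + 2 / (exp (2 * π * ((k:ℝ)+1)) - 1)) - 1 / ((k:ℝ)+1)) / (2 * ((k:ℝ)+1))) := by
  set a : ℝ := (k:ℝ)+1 with ha
  have ha0 : 0 < a := by positivity
  have hac : (a:ℂ) ≠ 0 := by exact_mod_cast ha0.ne'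
  have hx : (a:ℂ) * Complex.I ∈ Complex.integerComplement := by
    rintro ⟨m, hm⟩
    have := congrArg Complex.im hm
    simp at this
    exact ha0.ne this
  have h1 := cot_series_rep' hx
  have hs := (summable_cotTerm hx).hasSum
  have hE : 1 < exp (2 * π * a) := by
    rw [Real.one_lt_exp_iff]; positivity
  have hcot : Complex.cot (π * (a * Complex.I)) =
      -Complex.I * ((1 + 2 / (exp (2 * π * a) - 1) : ℝ) : ℂ) := by
    have h2 : Complex.exp (2 * Complex.I * (π * (a * Complex.I))) = ((exp (2 * π * a) : ℝ) : ℂ)⁻¹ := by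
      rw [Complex.ofReal_exp, ← Complex.exp_neg]
      congr 1
      push_cast
      linear_combination (2 * (π:ℂ) * a) * Complex.I_sq
    rw [Complex.cot_eq_exp_ratio, h2]
    generalize exp (2 * π * a) = E at hE
    have hE0 : (E:ℂ) ≠ 0 := by exact_mod_cast (by linarith : E ≠ 0)
    have hE1 : (E:ℂ) - 1 ≠ 0 := by exact_mod_cast (by linarith : E - 1 ≠ 0)
    have hE2 : 1 - (E:ℂ)⁻¹ ≠ 0 := by
      intro h; apply hE1; field_simp at h; simpa using h
    have hI := Complex.I_ne_zero
    push_cast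
    rw [div_eq_iff (mul_ne_zero hI hE2)]
    field_simp
    linear_combination ((E:ℂ) + 1) * Complex.I_sq
  have hterm : ∀ n : ℕ, cotTerm (a * Complex.I) n =
      (-2 * a * Complex.I) * ((1 / (a^2 + ((n:ℝ)+1)^2) : ℝ) : ℂ) := by
    intro n
    have hp : ((a:ℂ)^2 + ((n:ℂ)+1)^2) ≠ 0 := by
      exact_mod_cast (by positivity : a^2 + ((n:ℝ)+1)^2 ≠ 0)
    rw [cotTerm_identity hx]
    have : ((a:ℂ) * Complex.I + (n+1)) * (a * Complex.I - (n+1)) = -((a:ℂ)^2 + ((n:ℂ)+1)^2) := by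
      linear_combination (a:ℂ)^2 * Complex.I_sq
    rw [this]
    push_cast
    field_simp
  have hs2 : HasSum (fun n : ℕ => cotTerm (a * Complex.I) n) (π * Complex.cot (π * (a * Complex.I)) - 1 / (a * Complex.I)) := by
    rw [h1]; exact hs
  simp_rw [hterm] at hs2
  have hc : (-2 * a * Complex.I) ≠ 0 := by simp [hac]
  have hs3 := hs2.mul_left (-2 * a * Complex.I)⁻¹
  simp_rw [inv_mul_cancel_left₀ hc] at hs3
  rw [← Complex.hasSum_ofReal]
  suffices hv : (((π * (1 + 2 / (exp (2 * π * a) - 1)) - 1 / a) / (2 * a) : ℝ) : ℂ) =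
      (-2 * a * Complex.I)⁻¹ * (π * Complex.cot (π * (a * Complex.I)) - 1 / (a * Complex.I)) by
    rw [hv]; exact hs3
  rw [hcot]
  generalize (1 + 2 / (exp (2 * π * a) - 1)) = C
  push_cast
  rw [eq_inv_mul_iff_mul_eq₀ hc]
  field_simp
  linear_combination Complex.I_sq

lemma aux_shift {p : ℕ} (hp : p ≠ 0) {s : ℝ} (h : HasSum (fun n : ℕ => (1 : ℝ) / (n : ℝ) ^ p) s) :
    HasSum (fun n : ℕ => (1 : ℝ) / ((n : ℝ) + 1) ^ p) s := by
  have := (hasSum_nat_add_iff' 1).mpr h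
  simpa [hp] using this

lemma aux_mul {f : ℕ → ℝ} {s : ℝ} (h : HasSum f s)
    (h2 : Summable (fun p : ℕ × ℕ => f p.1 * f p.2)) :
    HasSum (fun p : ℕ × ℕ => f p.1 * f p.2) (s * s) := by
  have h3 := h.summable.tsum_mul_tsum h.summable h2
  rw [h.tsum_eq] at h3
  rw [h3]
  exact h2.hasSum

/-- `ζ(3) + 2 Σ_{k≥1} 1/(k³(e^{2πk}−1)) = 7π³/180`. -/
theorem zeta_three_lerch :
    (∑' m : ℕ, (1 : ℝ) / ((m : ℝ) + 1) ^ 3) +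
      2 * ∑' k : ℕ, (1 : ℝ) /
        (((k : ℝ) + 1) ^ 3 * (Real.exp (2 * Real.pi * ((k : ℝ) + 1)) - 1)) =
      7 * Real.pi ^ 3 / 180 := by
  have z2 := aux_shift (by norm_num) hasSum_zeta_two
  have z4 := aux_shift (by norm_num) hasSum_zeta_four
  have s3 : Summable (fun m : ℕ => (1 : ℝ) / ((m : ℝ) + 1) ^ 3) :=
    (aux_shift (by norm_num) (Real.summable_one_div_nat_pow.mpr (by norm_num : 1 < 3)).hasSum).summable
  have hE : ∀ k : ℕ, 1 ≤ Real.exp (2 * Real.pi * ((k : ℝ) + 1)) - 1 := by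
    intro k
    have h1 := Real.add_one_le_exp (2 * Real.pi * ((k : ℝ) + 1))
    have h2 := Real.pi_gt_three
    have h3 : (0:ℝ) ≤ k := by positivity
    nlinarith
  have sE : Summable (fun k : ℕ => (1 : ℝ) /
        (((k : ℝ) + 1) ^ 3 * (Real.exp (2 * Real.pi * ((k : ℝ) + 1)) - 1))) := by
    refine Summable.of_nonneg_of_le (fun k => ?_) (fun k => ?_) s3
    · have := hE k
      positivity
    · apply one_div_le_one_div_of_le (by positivity)
      exact le_mul_of_one_le_right (by positivity) (hE k)
  -- the double sum
  have hprod : HasSum (fun p : ℕ × ℕ => (1 : ℝ) / ((p.1 : ℝ) + 1) ^ 2 * (1 / ((p.2 : ℝ) + 1) ^ 2))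
      (Real.pi ^ 2 / 6 * (Real.pi ^ 2 / 6)) := by
    have h0 : (0 : ℕ → ℝ) ≤ fun n : ℕ => (1 : ℝ) / ((n : ℝ) + 1) ^ 2 := fun n => by
      simp only [Pi.zero_apply]; positivity
    have hs := z2.summable.mul_of_nonneg z2.summable h0 h0
    exact aux_mul z2 hs
  set F : ℕ × ℕ → ℝ := fun p =>
    1 / ((p.1 : ℝ) + 1) ^ 2 * (1 / (((p.1 : ℝ) + 1) ^ 2 + ((p.2 : ℝ) + 1) ^ 2)) with hF
  have sF : Summable F := by
    refine Summable.of_nonneg_of_le (fun p => by positivity) (fun p => ?_) hprod.summable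
    apply mul_le_mul_of_nonneg_left _ (by positivity)
    apply one_div_le_one_div_of_le (by positivity)
    nlinarith [sq_nonneg ((p.1 : ℝ) + 1)]
  obtain ⟨S, hS⟩ := sF
  have hS' : HasSum (fun p : ℕ × ℕ => F p.swap) S := (Equiv.prodComm ℕ ℕ).hasSum_iff.mpr hS
  have h2S : 2 * S = Real.pi ^ 2 / 6 * (Real.pi ^ 2 / 6) := by
    have := hS.add hS'
    rw [two_mul]
    refine this.unique ?_
    convert hprod using 2 with p
    simp only [hF, Prod.fst_swap, Prod.snd_swap]
    field_simp
    ring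
  have hfib := hS.prod_fiberwise (fun k => (aux_cot k).mul_left (1 / ((k : ℝ) + 1) ^ 2))
  have hA := (((s3.hasSum.add (sE.hasSum.mul_left 2)).mul_left Real.pi).sub z4).mul_left (1/2)
  have hfun : ∀ k : ℕ, (1 / ((k : ℝ) + 1) ^ 2 * ((Real.pi * (1 + 2 /
      (Real.exp (2 * Real.pi * ((k : ℝ) + 1)) - 1)) - 1 / ((k : ℝ) + 1)) / (2 * ((k : ℝ) + 1)))) =
      1 / 2 * (Real.pi * (1 / ((k : ℝ) + 1) ^ 3 + 2 * (1 / (((k : ℝ) + 1) ^ 3 *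
        (Real.exp (2 * Real.pi * ((k : ℝ) + 1)) - 1)))) - 1 / ((k : ℝ) + 1) ^ 4) := by
    intro k
    have := hE k
    generalize Real.exp (2 * Real.pi * ((k : ℝ) + 1)) - 1 = E at this
    have : E ≠ 0 := by linarith
    field_simp
  rw [funext hfun] at hfib
  have heq := hA.unique hfib
  have : Real.pi ≠ 0 := Real.pi_ne_zero
  apply mul_left_cancel₀ this
  linarith
end
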